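/- Orthogonality relation for the Weyl-Heisenberg group: for all f, g ∈ L²(ℝⁿ), ∫_{ℝⁿ}∫_{ℝⁿ}∫_𝕋 |⟨f, π̃(t,a,b)g⟩|² dt db da = ‖f‖₂² ‖g‖₂², where π̃(t,a,b)h(x) = t · e^{−2πi a·b} e^{2πi a·x} h(x−b) and 𝕋 is the unit circle with normalized measure. -/

import Mathlib

open Complex MeasureTheory

/-- The Weyl–Heisenberg representation on functions on `ℝⁿ`, with circle
parameter `w ∈ 𝕋 ⊆ ℂ`: `(π̃(w,a,b) h)(x) = w e^{-2πi a·b} e^{2πi a·x} h(x-b)`. -/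
noncomputable def weylRep {n : ℕ} (w : ℂ) (a b : Fin n → ℝ)
    (h : (Fin n → ℝ) → ℂ) : (Fin n → ℝ) → ℂ :=
  fun x =>
    w * Complex.exp (-(2 * Real.pi * Complex.I * (∑ i, a i * b i))) *
      Complex.exp (2 * Real.pi * Complex.I * (∑ i, a i * x i)) * h (x - b)

open FourierTransform

lemma weyl_lintegral_Lp {α : Type*} [MeasurableSpace α] {μ : Measure α} (u : Lp ℂ 2 μ) :
    ∫⁻ x, ‖u x‖ₑ ^ 2 ∂μ = ENNReal.ofReal (‖u‖ ^ 2) := by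
  have h := eLpNorm_nnreal_pow_eq_lintegral (f := u) (μ := μ) (p := 2) (by norm_num)
  rw [Lp.norm_def, ← ENNReal.toReal_pow, ENNReal.ofReal_toReal
    (ENNReal.pow_ne_top (Lp.eLpNorm_ne_top u))]
  simpa using h.symm

lemma weyl_planch {E : Type*} [NormedAddCommGroup E] [InnerProductSpace ℝ E]
    [FiniteDimensional ℝ E] [MeasurableSpace E] [BorelSpace E] (F : E → ℂ)
    (h1 : Integrable F) (h2 : MemLp F 2) :
    ∫⁻ ξ, ‖𝓕 F ξ‖ₑ ^ 2 = ∫⁻ x, ‖F x‖ₑ ^ 2 := by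
  set u : Lp ℂ 2 (volume : Measure E) := h2.toLp F with hu
  have key : (𝓕 u : Lp ℂ 2 (volume : Measure E)) =ᵐ[volume] 𝓕 F := by
    apply ae_eq_of_integral_contDiff_smul_eq
    · exact ((Lp.memLp _).locallyIntegrable (by norm_num))
    · apply Continuous.locallyIntegrable
      exact VectorFourier.fourierIntegral_continuous Real.continuous_fourierChar
        (by exact continuous_inner) h1
    intro g hg hc
    have hc' : HasCompactSupport (fun x => (g x : ℂ)) :=
      hc.comp_left (g := fun t : ℝ => (t : ℂ)) (by simp)
    have hg' : ContDiff ℝ (⊤ : ℕ∞) (fun x => (g x : ℂ)) := Complex.ofRealCLM.contDiff.comp hg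
    set G : SchwartzMap E ℂ := hc'.toSchwartzMap hg' with hG
    have hGg : ∀ x, G x = g x := fun x => rfl
    have e1 := congrArg (fun T => T G) (Lp.fourier_toTemperedDistribution_eq u)
    simp only [TemperedDistribution.fourier_apply, Lp.toTemperedDistribution_apply] at e1
    have e2 := VectorFourier.integral_fourierIntegral_smul_eq_flip (L := innerₗ E) (f := G) (g := F)
      (μ := volume) (ν := volume) Real.continuous_fourierChar continuous_inner G.integrable h1
    have e3 : ∫ x, (𝓕 G) x • u x = ∫ x, (𝓕 G) x • F x := by
      apply integral_congr_ae
      filter_upwards [h2.coeFn_toLp] with x hx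
      rw [hx]
    rw [e3] at e1
    rw [flip_innerₗ] at e2
    simp only [hGg] at e1 e2
    have e4 := e1.symm.trans e2
    simp only [Complex.real_smul]
    exact e4
  have l1 : ∫⁻ ξ, ‖𝓕 F ξ‖ₑ ^ 2 = ENNReal.ofReal (‖(𝓕 u : Lp ℂ 2 (volume : Measure E))‖ ^ 2) := by
    rw [← weyl_lintegral_Lp]
    apply lintegral_congr_ae
    filter_upwards [key] with x hx
    rw [hx]
  have l2 : ∫⁻ x, ‖F x‖ₑ ^ 2 = ENNReal.ofReal (‖u‖ ^ 2) := by
    rw [← weyl_lintegral_Lp]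
    apply lintegral_congr_ae
    filter_upwards [h2.coeFn_toLp] with x hx
    rw [hx]
  rw [l1, l2, Lp.norm_fourier_eq]

lemma weyl_planch_pi {n : ℕ} (F : (Fin n → ℝ) → ℂ) (h1 : Integrable F) (h2 : MemLp F 2) :
    ∫⁻ a : Fin n → ℝ, ‖∫ x : Fin n → ℝ,
      F x * Complex.exp (-(2 * Real.pi * Complex.I * (∑ i, a i * x i)))‖ₑ ^ 2
      = ∫⁻ x, ‖F x‖ₑ ^ 2 := by
  have hp := PiLp.volume_preserving_ofLp (Fin n)
  have hq := PiLp.volume_preserving_toLp (Fin n)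
  have hqe : MeasurableEmbedding (WithLp.toLp 2 : (Fin n → ℝ) → EuclideanSpace ℝ (Fin n)) :=
    (MeasurableEquiv.toLp 2 (Fin n → ℝ)).measurableEmbedding
  have key := weyl_planch (fun y : EuclideanSpace ℝ (Fin n) => F (WithLp.ofLp y))
    (hp.integrable_comp_of_integrable h1) (h2.comp_measurePreserving hp)
  rw [← hq.lintegral_comp_emb hqe, ← hq.lintegral_comp_emb hqe] at key
  rw [← key]
  congr 1
  ext a
  congr 2
  rw [Real.fourier_eq, ← hq.integral_comp hqe]
  congr 1
  ext x
  rw [Circle.smul_def, Real.fourierChar_apply, smul_eq_mul, mul_comm]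
  congr 2
  simp [PiLp.inner_apply]
  ring

theorem weylRep_orthogonality {n : ℕ}
    (f g : Lp ℂ 2 (volume : Measure (Fin n → ℝ))) :
    (∫ a : Fin n → ℝ, ∫ b : Fin n → ℝ, ∫ t in Set.Ico (0:ℝ) 1,
      ‖∫ x : Fin n → ℝ,
        f x * (starRingEnd ℂ)
          (weylRep (Complex.exp (2 * Real.pi * Complex.I * t)) a b (⇑g) x)‖ ^ 2)
      = ‖f‖ ^ 2 * ‖g‖ ^ 2 := by
  have hf : StronglyMeasurable f := Lp.stronglyMeasurable f
  have hg : StronglyMeasurable g := Lp.stronglyMeasurable g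
  set V : (Fin n → ℝ) × (Fin n → ℝ) → ℂ := fun p => ∫ x : Fin n → ℝ,
    (f x * (starRingEnd ℂ) (g (x - p.2))) *
      Complex.exp (-(2 * Real.pi * Complex.I * (∑ i, p.1 i * x i))) with hV
  have hnorm : ∀ (t : ℝ) (a b : Fin n → ℝ), ‖∫ x : Fin n → ℝ,
        f x * (starRingEnd ℂ)
          (weylRep (Complex.exp (2 * Real.pi * Complex.I * t)) a b (⇑g) x)‖ = ‖V (a, b)‖ := by
    intro t a b
    set c : ℂ := (starRingEnd ℂ) (Complex.exp (2 * Real.pi * Complex.I * t) *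
      Complex.exp (-(2 * Real.pi * Complex.I * (∑ i, a i * b i)))) with hc
    have hc1 : ‖c‖ = 1 := by
      rw [hc, RCLike.norm_conj, norm_mul, Complex.norm_exp, Complex.norm_exp]
      simp [← Complex.ofReal_mul, ← Complex.ofReal_sum]
    have : ∀ x : Fin n → ℝ, f x * (starRingEnd ℂ)
          (weylRep (Complex.exp (2 * Real.pi * Complex.I * t)) a b (⇑g) x) =
        c * ((f x * (starRingEnd ℂ) (g (x - b))) *
      Complex.exp (-(2 * Real.pi * Complex.I * (∑ i, a i * x i)))) := by
      intro x
      have : Complex.exp (-(2 * Real.pi * Complex.I * (∑ i, a i * x i))) =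
        (starRingEnd ℂ) (Complex.exp (2 * Real.pi * Complex.I * (∑ i, a i * x i))) := by
        rw [← Complex.exp_conj]
        simp only [map_mul, Complex.conj_I, Complex.conj_ofReal, map_ofNat]
        congr 1
        ring
      rw [this]
      simp only [weylRep, hc, map_mul]
      ring
    simp_rw [this]
    rw [integral_const_mul, norm_mul, hc1, one_mul]
  simp_rw [hnorm]
  have hVm : StronglyMeasurable V := by
    apply StronglyMeasurable.integral_prod_right
      (f := fun (p : (Fin n → ℝ) × (Fin n → ℝ)) (x : Fin n → ℝ) =>
        (f x * (starRingEnd ℂ) (g (x - p.2))) *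
        Complex.exp (-(2 * Real.pi * Complex.I * (∑ i, p.1 i * x i))))
    apply StronglyMeasurable.mul
    · apply StronglyMeasurable.mul
      · exact hf.comp_measurable measurable_snd
      · exact Complex.continuous_conj.comp_stronglyMeasurable
          (hg.comp_measurable (by fun_prop))
    · apply Continuous.stronglyMeasurable
      fun_prop
  have hm : Measurable (fun p : (Fin n → ℝ) × (Fin n → ℝ) =>
      ‖f p.2 * (starRingEnd ℂ) (g (p.2 - p.1))‖ₑ ^ 2) := by
    have := hf.measurable
    have := hg.measurable
    simp only [enorm_mul, RCLike.enorm_conj]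
    fun_prop
  have hI : ∫⁻ b : Fin n → ℝ, ∫⁻ x : Fin n → ℝ, ‖f x * (starRingEnd ℂ) (g (x - b))‖ₑ ^ 2
      = ENNReal.ofReal (‖f‖ ^ 2 * ‖g‖ ^ 2) := by
    rw [lintegral_lintegral_swap hm.aemeasurable]
    have : ∀ x : Fin n → ℝ, ∫⁻ b : Fin n → ℝ, ‖f x * (starRingEnd ℂ) (g (x - b))‖ₑ ^ 2
        = ‖f x‖ₑ ^ 2 * ENNReal.ofReal (‖g‖ ^ 2) := by
      intro x
      simp_rw [enorm_mul, mul_pow, RCLike.enorm_conj]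
      rw [lintegral_const_mul' _ _ (by simp), ← weyl_lintegral_Lp g,
        lintegral_sub_left_eq_self (fun y => ‖g y‖ₑ ^ 2) x]
    simp_rw [this]
    rw [lintegral_mul_const' _ _ (by simp), weyl_lintegral_Lp, ENNReal.ofReal_mul (by positivity)]
  have hL : ∫⁻ p : (Fin n → ℝ) × (Fin n → ℝ), ‖V p‖ₑ ^ 2 = ENNReal.ofReal (‖f‖ ^ 2 * ‖g‖ ^ 2) := by
    rw [Measure.volume_eq_prod, lintegral_prod_symm _ (hVm.enorm.pow_const 2).aemeasurable, ← hI]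
    apply lintegral_congr_ae
    have hfin := ae_lt_top (hm.lintegral_prod_right') (by rw [hI]; exact ENNReal.ofReal_ne_top)
    filter_upwards [hfin] with b hb
    have hgb : MemLp (fun x => (starRingEnd ℂ) (g (x - b))) 2 volume :=
      ((Lp.memLp g).comp_measurePreserving (measurePreserving_sub_right volume b)).star
    apply weyl_planch_pi (fun x => f x * (starRingEnd ℂ) (g (x - b)))
    · exact (Lp.memLp f).integrable_mul hgb
    · refine ⟨(Lp.memLp f).1.mul hgb.1, ?_⟩
      have h := eLpNorm_nnreal_pow_eq_lintegral
        (f := fun x => f x * (starRingEnd ℂ) (g (x - b))) (μ := volume) (p := 2) (by norm_num)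
      by_contra hcon
      have htop : eLpNorm (fun x => f x * (starRingEnd ℂ) (g (x - b))) 2 volume = ⊤ := by
        simpa using hcon
      simp only [ENNReal.coe_ofNat, NNReal.coe_ofNat, ENNReal.rpow_ofNat, htop] at h
      rw [← h] at hb
      simp at hb
  have hnn : ∀ p, ENNReal.ofReal (‖V p‖ ^ 2) = ‖V p‖ₑ ^ 2 := by
    intro p
    rw [ENNReal.ofReal_pow (norm_nonneg _), ofReal_norm]
  have hsm : AEStronglyMeasurable (fun p => ‖V p‖ ^ 2) volume :=
    (hVm.norm.pow 2).aestronglyMeasurable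
  have hint : Integrable (fun p => ‖V p‖ ^ 2) := by
    refine ⟨hsm, ?_⟩
    rw [hasFiniteIntegral_iff_ofReal (Filter.Eventually.of_forall fun p => by positivity)]
    simp_rw [hnn]
    rw [hL]
    exact ENNReal.ofReal_lt_top
  have h1 : ∫ p, ‖V p‖ ^ 2 = ‖f‖ ^ 2 * ‖g‖ ^ 2 := by
    rw [integral_eq_lintegral_of_nonneg_ae (Filter.Eventually.of_forall fun p => by positivity) hsm]
    simp_rw [hnn]
    rw [hL, ENNReal.toReal_ofReal (by positivity)]
  rw [← h1, Measure.volume_eq_prod, integral_prod _ hint]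
  simp
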